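/- Let n ≥ 1 and r ≥ n. Consider polynomials g ∈ ℚ[α, t_1, …, t_r] that are homogeneous of total degree n, that are ℚ[α]-linear combinations of quasi-symmetric monomials in the variables t_1, …, t_r, that satisfy (with α treated as a fixed coefficient variable) the q-th cancellation relation in the t-variables for every q with 1 ≤ q ≤ r−1, and that satisfy g(−α, t_1, …, t_{r−1}, α) = g(α, t_1, …, t_{r−1}, 0). These polynomials form a ℚ-vector subspace of dimension c_n, the n-th Fibonacci number. -/

import Mathlib

open scoped Classical
open MvPolynomial

/-- We work in `ℚ[α, t_1, …, t_r]`, realized as multivariate polynomials on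
`Option (Fin r)`, where the variable `none` is `α` and `some i` is `t_{i+1}`. -/
abbrev PolyAT (r : ℕ) : Type := MvPolynomial (Option (Fin r)) ℚ

/-- The quasi-symmetric monomial `M_ω` in the variables `t_1, …, t_r`. -/
noncomputable def qsymMonomial (r : ℕ) (ω : List ℕ+) : PolyAT r :=
  ∑ l ∈ Finset.univ.filter (fun l : Fin ω.length → Fin r => StrictMono l),
    ∏ i : Fin ω.length, X (some (l i)) ^ ((ω.get i : ℕ))

/-- `g` satisfies the `q`-th cancellation relation in the `t`-variables (with `α` fixed;
here `q` is `0`-indexed, `0 ≤ q ≤ r-2`): substituting `s` for `t_q` and `-s` for `t_{q+1}`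
gives the same polynomial as substituting `0` for both. -/
def CancelRel {r : ℕ} (g : PolyAT r) (q : ℕ) (hq : q + 1 < r) : Prop :=
  aeval (fun j : Option (Fin r) =>
      match j with
      | none => (X none : PolyAT r)
      | some j =>
          if (j : ℕ) = q then X (some ⟨q, by omega⟩)
          else if (j : ℕ) = q + 1 then -X (some ⟨q, by omega⟩)
          else X (some j)) g =
  aeval (fun j : Option (Fin r) =>
      match j with
      | none => (X none : PolyAT r)
      | some j =>
          if (j : ℕ) = q then 0
          else if (j : ℕ) = q + 1 then 0
          else X (some j)) g

/-- `g(−α, t_1, …, t_{r−1}, α) = g(α, t_1, …, t_{r−1}, 0)`. -/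
def AlphaRel (r : ℕ) (g : PolyAT r) : Prop :=
  aeval (fun j : Option (Fin r) =>
      match j with
      | none => (-X none : PolyAT r)
      | some j => if (j : ℕ) = r - 1 then X none else X (some j)) g =
  aeval (fun j : Option (Fin r) =>
      match j with
      | none => (X none : PolyAT r)
      | some j => if (j : ℕ) = r - 1 then 0 else X (some j)) g


open Finset (range)
open Finset.HasAntidiagonal (antidiagonal mem_antidiagonal)

noncomputable def zSeq {A : Type*} [Ring A] [Algebra ℚ A] (x : ℕ → A) (N : ℕ) : A :=
  if N = 0 then 1 else if Odd N then x N else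
    -((1/2 : ℚ) • ∑ a : Fin N, if (a : ℕ) = 0 then 0 else
      (-1 : ℚ) ^ (N - a) • (zSeq x a * (if h : (a : ℕ) = 0 then 0 else zSeq x (N - a))))
termination_by N
decreasing_by
  · exact a.2
  · omega

theorem exists_z {A : Type*} [Ring A] [Algebra ℚ A] (x : ℕ → A) :
    ∃ z : ℕ → A, z 0 = 1 ∧ (∀ i, Odd i → z i = x i) ∧
      ∀ N, 1 ≤ N → ∑ p ∈ antidiagonal N, (-1 : ℚ) ^ p.2 • (z p.1 * z p.2) = 0 := by
  have h0 : zSeq x 0 = 1 := by rw [zSeq]; simp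
  have hodd : ∀ i, Odd i → zSeq x i = x i := by
    intro i hi
    rw [zSeq, if_neg (by rintro rfl; simp at hi), if_pos hi]
  have heven : ∀ N, 1 ≤ N → ¬ Odd N →
      ∑ p ∈ antidiagonal N, (-1 : ℚ) ^ p.2 • (zSeq x p.1 * zSeq x p.2) = 0 := by
    intro N hN ho
    have key : zSeq x N = -((1/2 : ℚ) • ∑ k ∈ range N, if k = 0 then 0 else
      (-1 : ℚ) ^ (N - k) • (zSeq x k * zSeq x (N - k))) := by
      conv_lhs => rw [zSeq, if_neg (by omega), if_neg ho]
      congr 2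
      rw [← Fin.sum_univ_eq_sum_range (fun k => if k = 0 then 0 else
        (-1 : ℚ) ^ (N - k) • (zSeq x k * zSeq x (N - k)))]
      apply Finset.sum_congr rfl
      intro a _
      by_cases h : (a : ℕ) = 0
      · simp [h]
      · simp [h]
    rw [Finset.Nat.sum_antidiagonal_eq_sum_range_succ
      (fun a b => (-1 : ℚ) ^ b • (zSeq x a * zSeq x b)), Finset.sum_range_succ]
    have hev : (-1 : ℚ) ^ N = 1 := Even.neg_one_pow (by simpa using ho)
    obtain ⟨M, rfl⟩ : ∃ M, N = M + 1 := ⟨N - 1, by omega⟩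
    rw [Finset.sum_range_succ'] at key ⊢
    simp only [Nat.add_eq_zero_iff, one_ne_zero, and_false, if_false, if_true, add_zero] at key
    simp only [Nat.sub_zero, Nat.sub_self, h0, pow_zero, one_smul, one_mul, mul_one, hev]
    rw [add_assoc, ← two_smul ℚ (zSeq x (M+1)), key, smul_neg, smul_smul]
    norm_num
  refine ⟨zSeq x, h0, hodd, ?_⟩
  set z := zSeq x
  let U : ℕ → A := fun N => ∑ p ∈ antidiagonal N, (-1 : ℚ) ^ p.2 • (z p.1 * z p.2)
  let Z : PowerSeries A := PowerSeries.mk z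
  let Z' : PowerSeries A := PowerSeries.mk fun n => (-1 : ℚ) ^ n • z n
  have hU : ∀ N, PowerSeries.coeff N (Z * Z') = U N := by
    intro N
    simp [Z, Z', U, PowerSeries.coeff_mul]
  have hV : ∀ N, PowerSeries.coeff N (Z' * Z) = (-1 : ℚ) ^ N • U N := by
    intro N
    simp only [Z, Z', U, PowerSeries.coeff_mul, PowerSeries.coeff_mk, Finset.smul_sum]
    apply Finset.sum_congr rfl
    rintro ⟨a, b⟩ hab
    simp only [mem_antidiagonal] at hab
    subst hab
    rw [smul_smul, smul_mul_assoc]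
    congr 1
    rw [pow_add, mul_assoc, ← mul_pow]; simp
  have hU0 : U 0 = 1 := by simp [U, h0]
  intro N
  change 1 ≤ N → U N = 0
  induction N using Nat.strong_induction_on with
  | _ N ih =>
  intro hN
  by_cases ho : Odd N
  · have e : PowerSeries.coeff N (Z * (Z' * Z)) = PowerSeries.coeff N ((Z * Z') * Z) := by
      rw [mul_assoc]
    rw [PowerSeries.coeff_mul, PowerSeries.coeff_mul] at e
    simp only [hU, hV] at e
    obtain ⟨M, rfl⟩ : ∃ M, N = M + 1 := ⟨N - 1, by omega⟩
    rw [Finset.Nat.sum_antidiagonal_succ] at e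
    rw [Finset.Nat.sum_antidiagonal_succ'] at e
    rw [Finset.sum_eq_single (M, 0), Finset.sum_eq_single (0, M)] at e
    · simp only [hU0, pow_zero, one_smul, mul_one, one_mul, Z, PowerSeries.coeff_mk, h0,
        zero_add, ho.neg_one_pow, neg_smul] at e
      have e2 : (2 : ℚ) • U (M + 1) = 0 := by
        rw [two_smul]
        have := congrArg (fun y => U (M + 1) + y - z (M + 1)) e
        calc U (M+1) + U (M+1) = U (M + 1) + (U (M + 1) + z (M + 1)) - z (M + 1) := by abel
          _ = _ := by rw [← this]; abel
      simpa using e2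
    · rintro ⟨a, b⟩ hab hne
      simp only [mem_antidiagonal] at hab
      have : a ≠ 0 := by rintro rfl; apply hne; simp; omega
      simp only
      rw [ih a (by omega) (by omega), zero_mul]
    · intro h; simp at h
    · rintro ⟨a, b⟩ hab hne
      simp only [mem_antidiagonal] at hab
      have : b ≠ 0 := by rintro rfl; apply hne; simp; omega
      simp only
      rw [ih b (by omega) (by omega), smul_zero, mul_zero]
    · intro h; simp at h
  · exact heven N hN ho

def bumpHead : List ℕ → List ℕ
  | [] => []
  | x :: xs => (x + 2) :: xs

theorem bumpHead_injective : Function.Injective bumpHead := by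
  intro a b h
  cases a <;> cases b <;> simp_all [bumpHead]

/-- odd compositions of `k + 1` -/
noncomputable def oddComp : ℕ → Finset (List ℕ)
  | 0 => {[1]}
  | 1 => {[1, 1]}
  | (k + 2) => (oddComp (k + 1)).image (fun l => 1 :: l) ∪ (oddComp k).image bumpHead

theorem mem_oddComp : ∀ (k : ℕ) (c : List ℕ),
    c ∈ oddComp k ↔ (∀ x ∈ c, Odd x) ∧ c.sum = k + 1
  | 0, c => by
    rw [oddComp, Finset.mem_singleton]
    constructor
    · rintro rfl; simp
    · rintro ⟨h, hs⟩
      rcases c with _ | ⟨x, _ | ⟨y, l⟩⟩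
      · simp at hs
      · simp at hs; simp [hs]
      · have := (h x (by simp)).pos
        have := (h y (by simp)).pos
        simp at hs; omega
  | 1, c => by
    rw [oddComp, Finset.mem_singleton]
    constructor
    · rintro rfl; simp
    · rintro ⟨h, hs⟩
      rcases c with _ | ⟨x, _ | ⟨y, _ | ⟨w, l⟩⟩⟩
      · simp at hs
      · simp at hs; subst hs; have := h 2 (by simp); revert this; decide
      · have := (h x (by simp)).pos
        have := (h y (by simp)).pos
        simp at hs; simp; omega
      · have := (h x (by simp)).pos
        have := (h y (by simp)).pos
        have := (h w (by simp)).pos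
        simp at hs; omega
  | (k + 2), c => by
    rw [oddComp, Finset.mem_union, Finset.mem_image, Finset.mem_image]
    constructor
    · rintro (⟨l, hl, rfl⟩ | ⟨l, hl, rfl⟩)
      · rw [mem_oddComp] at hl
        refine ⟨by simpa using hl.1, by simp [hl.2]; omega⟩
      · rw [mem_oddComp] at hl
        rcases l with _ | ⟨x, l⟩
        · simp at hl
        · simp only [bumpHead, List.mem_cons, forall_eq_or_imp, List.sum_cons] at hl ⊢
          refine ⟨⟨hl.1.1.add_even (by decide), hl.1.2⟩, by omega⟩
    · rintro ⟨h, hs⟩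
      rcases c with _ | ⟨x, l⟩
      · simp at hs
      · simp only [List.mem_cons, forall_eq_or_imp, List.sum_cons] at h hs
        by_cases hx : x = 1
        · left
          refine ⟨l, ?_, by rw [hx]⟩
          rw [mem_oddComp]
          exact ⟨h.2, by omega⟩
        · right
          obtain ⟨m, hm⟩ := h.1
          obtain ⟨y, rfl⟩ : ∃ y, x = y + 2 := ⟨x - 2, by omega⟩
          refine ⟨y :: l, ?_, rfl⟩
          rw [mem_oddComp]
          refine ⟨?_, by simp; omega⟩
          simp only [List.mem_cons, forall_eq_or_imp]
          exact ⟨⟨m - 1, by omega⟩, h.2⟩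

theorem card_oddComp : ∀ k : ℕ, (oddComp k).card = Nat.fib (k + 1)
  | 0 => by simp [oddComp]
  | 1 => by simp [oddComp]
  | (k + 2) => by
    rw [oddComp, Finset.card_union_of_disjoint, Finset.card_image_of_injective _
      (List.cons_injective), Finset.card_image_of_injective _ bumpHead_injective,
      card_oddComp, card_oddComp, Nat.fib_add_two (n := k + 1), add_comm]
    rw [Finset.disjoint_left]
    intro c h1 h2
    rw [Finset.mem_image] at h1 h2
    obtain ⟨l, hl, rfl⟩ := h1
    obtain ⟨l', hl', h⟩ := h2
    cases l' <;> simp [bumpHead] at h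

section merge
variable {σ : Type*} [Fintype σ]

theorem aeval_merge_monomial (p p' : σ) (h : p ≠ p') (u v : ℚ) (F : σ → MvPolynomial σ ℚ)
    (hp : F p = C u * X p) (hp' : F p' = C v * X p) (hF : ∀ i, i ≠ p → i ≠ p' → F i = X i)
    (d0 : σ →₀ ℕ) (h0 : d0 p = 0) (h0' : d0 p' = 0) (i j : ℕ) (c : ℚ) :
    aeval F (monomial (d0 + Finsupp.single p i + Finsupp.single p' j) c) =
      monomial (d0 + Finsupp.single p (i + j)) (c * u ^ i * v ^ j) := by
  have key : ∀ d : σ →₀ ℕ, d p = 0 → d p' = 0 → aeval F (monomial d (1 : ℚ)) = monomial d 1 := by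
    intro d hd hd'
    rw [aeval_monomial, monomial_eq]
    simp only [map_one, one_mul]
    apply Finsupp.prod_congr
    intro x hx
    rw [hF x]
    · rintro rfl; simp [hd] at hx
    · rintro rfl; simp [hd'] at hx
  have e1 : (monomial (d0 + Finsupp.single p i + Finsupp.single p' j) c : MvPolynomial σ ℚ)
      = C c * (monomial d0 1) * X p ^ i * X p' ^ j := by
    rw [C_mul_monomial, X_pow_eq_monomial, X_pow_eq_monomial, monomial_mul, monomial_mul]; simp
  have e2 : (monomial (d0 + Finsupp.single p (i + j)) (c * u ^ i * v ^ j) : MvPolynomial σ ℚ)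
      = C c * (monomial d0 1) * (C u ^ i * X p ^ i) * (C v ^ j * X p ^ j) := by
    rw [show C c * (monomial d0 1) * (C u ^ i * X p ^ i) * (C v ^ j * X p ^ j) =
      (C c * C u ^ i * C v ^ j) * ((monomial d0 1) * (X p ^ (i + j)) : MvPolynomial σ ℚ) by ring]
    rw [X_pow_eq_monomial, monomial_mul, ← map_pow, ← map_pow, ← map_mul, ← map_mul, C_mul_monomial]
    simp
  rw [e1, e2]
  simp only [map_mul, map_pow, key d0 h0 h0', aeval_X, hp, hp', mul_pow]
  simp

theorem exists_split (p p' : σ) (h : p ≠ p') (d : σ →₀ ℕ) :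
    ∃ d0 : σ →₀ ℕ, d0 p = 0 ∧ d0 p' = 0 ∧
      d = d0 + Finsupp.single p (d p) + Finsupp.single p' (d p') := by
  refine ⟨(d.erase p).erase p', by simp [h], by simp, ?_⟩
  ext x
  by_cases h1 : x = p
  · subst h1; simp [h, h.symm]
  · by_cases h2 : x = p'
    · subst h2; simp [h]
    · simp [h1, h2, Ne.symm h1, Ne.symm h2]

theorem split_inj (p p' : σ) (h : p ≠ p') (d0 e0 : σ →₀ ℕ) (h0 : d0 p = 0) (h0' : d0 p' = 0)
    (k0 : e0 p = 0) (k0' : e0 p' = 0) (i j a b : ℕ) :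
    d0 + Finsupp.single p i + Finsupp.single p' j =
      e0 + Finsupp.single p a + Finsupp.single p' b ↔ d0 = e0 ∧ i = a ∧ j = b := by
  constructor
  · intro H
    have H1 := DFunLike.congr_fun H p
    have H2 := DFunLike.congr_fun H p'
    simp [h, h.symm, h0, h0', k0, k0'] at H1 H2
    subst H1 H2
    simpa using H
  · rintro ⟨rfl, rfl, rfl⟩; rfl

theorem coeff_merge (p p' : σ) (h : p ≠ p') (u v : ℚ) (F : σ → MvPolynomial σ ℚ)
    (hp : F p = C u * X p) (hp' : F p' = C v * X p) (hF : ∀ i, i ≠ p → i ≠ p' → F i = X i)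
    (g : MvPolynomial σ ℚ)
    (e0 : σ →₀ ℕ) (h0 : e0 p = 0) (h0' : e0 p' = 0) (N M : ℕ) :
    coeff (e0 + Finsupp.single p N + Finsupp.single p' M) (aeval F g) =
      if M = 0 then ∑ x ∈ Finset.HasAntidiagonal.antidiagonal N, u ^ x.1 * v ^ x.2 *
        coeff (e0 + Finsupp.single p x.1 + Finsupp.single p' x.2) g else 0 := by
  induction g using MvPolynomial.induction_on' with
  | add g1 g2 ih1 ih2 =>
    simp only [map_add, coeff_add, ih1, ih2]
    split_ifs
    · rw [← Finset.sum_add_distrib]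
      apply Finset.sum_congr rfl; intros; ring
    · simp
  | monomial d c =>
    obtain ⟨d0, hd, hd', hdd⟩ := exists_split p p' h d
    generalize d p = i at hdd
    generalize d p' = j at hdd
    subst hdd
    rw [aeval_merge_monomial p p' h u v F hp hp' hF d0 hd hd']
    simp only [coeff_monomial, split_inj p p' h d0 e0 hd hd' h0 h0']
    have := split_inj p p' h d0 e0 hd hd' h0 h0' (i + j) 0 N M
    rw [Finsupp.single_zero, add_zero] at this
    simp only [this]
    by_cases hM : M = 0
    · subst hM
      simp only [if_true, and_true]
      by_cases hN : i + j = N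
      · rw [Finset.sum_eq_single (i, j)]
        · simp [hN]
          split_ifs <;> ring
        · rintro ⟨a, b⟩ _ hne
          rw [if_neg]; simp
          rintro ⟨_, rfl, rfl⟩; exact hne rfl
        · intro hh; simp [hN] at hh
      · rw [if_neg (by tauto), Finset.sum_eq_zero]
        rintro ⟨a, b⟩ hab
        rw [if_neg]; simp
        rintro ⟨_, rfl, rfl⟩; simp at hab; exact hN hab
    · rw [if_neg hM, if_neg]
      rintro ⟨_, _, h⟩; exact hM h.symm

theorem coeff_kill (S : Set σ) (F : σ → MvPolynomial σ ℚ)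
    (hS : ∀ i ∈ S, F i = 0) (hF : ∀ i, i ∉ S → F i = X i)
    (g : MvPolynomial σ ℚ) (e : σ →₀ ℕ) :
    coeff e (aeval F g) = if ∀ i ∈ S, e i = 0 then coeff e g else 0 := by
  induction g using MvPolynomial.induction_on' with
  | add g1 g2 ih1 ih2 =>
    simp only [map_add, coeff_add, ih1, ih2]
    split_ifs <;> simp
  | monomial d c =>
    by_cases hd : ∀ i ∈ S, d i = 0
    · have : aeval F (monomial d c) = monomial d c := by
        rw [aeval_monomial, monomial_eq]
        congr 1
        apply Finsupp.prod_congr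
        intro x hx
        rw [hF x]
        intro hxS; simp [hd x hxS] at hx
      rw [this, coeff_monomial]
      split_ifs with h1 h2 h2
      · rfl
      · subst h1; exact absurd hd h2
      · rfl
      · rfl
    · have : aeval F (monomial d c) = 0 := by
        push Not at hd
        obtain ⟨i, hi, hdi⟩ := hd
        rw [aeval_monomial, Finsupp.prod, Finset.prod_eq_zero (i := i), mul_zero]
        · simpa using hdi
        · rw [hS i hi, zero_pow hdi]
      rw [this, coeff_monomial, coeff_zero]
      split_ifs with h1 h2 h2
      · subst h2; exact absurd h1 hd
      · rfl
      · rfl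
end merge

theorem cancel_iff {r : ℕ} (g : PolyAT r) (q : ℕ) (hq : q + 1 < r) :
    CancelRel g q hq ↔ ∀ e0 : Option (Fin r) →₀ ℕ, e0 (some ⟨q, by omega⟩) = 0 →
      e0 (some ⟨q + 1, hq⟩) = 0 → ∀ N, 1 ≤ N →
      ∑ x ∈ antidiagonal N, (-1 : ℚ) ^ x.2 * coeff (e0 + Finsupp.single (some ⟨q, by omega⟩) x.1 +
        Finsupp.single (some ⟨q + 1, hq⟩) x.2) g = 0 := by
  have hne : (some ⟨q, by omega⟩ : Option (Fin r)) ≠ some ⟨q + 1, hq⟩ := by simp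
  unfold CancelRel
  have H1 := coeff_merge (some ⟨q, by omega⟩ : Option (Fin r)) (some ⟨q + 1, hq⟩) hne 1 (-1)
    (fun j : Option (Fin r) =>
      match j with
      | none => (X none : PolyAT r)
      | some j =>
          if (j : ℕ) = q then X (some ⟨q, by omega⟩)
          else if (j : ℕ) = q + 1 then -X (some ⟨q, by omega⟩)
          else X (some j)) (by simp) (by simp) (by
        rintro (_ | i) h1 h2
        · rfl
        · simp [Fin.ext_iff] at h1 h2
          simp [h1, h2]) g
  have H2 := coeff_kill ({some ⟨q, by omega⟩, some ⟨q + 1, hq⟩} : Set (Option (Fin r)))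
    (fun j : Option (Fin r) =>
      match j with
      | none => (X none : PolyAT r)
      | some j =>
          if (j : ℕ) = q then 0
          else if (j : ℕ) = q + 1 then 0
          else X (some j)) (by rintro i (rfl | rfl) <;> simp) (by
        rintro (_ | i) h1
        · rfl
        · simp [Fin.ext_iff] at h1
          simp [h1]) g
  rw [MvPolynomial.ext_iff]
  constructor
  · intro H e0 h0 h0' N hN
    have := H (e0 + Finsupp.single (some ⟨q, by omega⟩) N + Finsupp.single (some ⟨q + 1, hq⟩) 0)
    rw [H1 e0 h0 h0', H2, if_pos rfl, if_neg] at this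
    · simpa using this
    · intro hh
      have := hh (some ⟨q, by omega⟩) (by simp)
      simp at this; omega
  · intro H d
    obtain ⟨d0, hd, hd', hdd⟩ := exists_split _ _ hne d
    generalize d (some ⟨q, by omega⟩) = N at hdd
    generalize d (some ⟨q + 1, hq⟩) = M at hdd
    subst hdd
    rw [H1 d0 hd hd', H2]
    by_cases hM : M = 0
    · subst hM
      by_cases hN : N = 0
      · subst hN
        rw [if_pos rfl, if_pos]
        · simp
        · rintro i (rfl | rfl) <;> simp [hd, hd']
      · rw [if_pos rfl, if_neg]
        · simpa using H d0 hd hd' N (by omega)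
        · intro hh
          have := hh (some ⟨q, by omega⟩) (by simp)
          simp at this; omega
    · rw [if_neg hM, if_neg]
      intro hh
      have := hh (some ⟨q + 1, hq⟩) (by simp)
      simp at this; omega

theorem alpha_iff {r : ℕ} (hr : 0 < r) (g : PolyAT r) :
    AlphaRel r g ↔ ∀ e0 : Option (Fin r) →₀ ℕ, e0 none = 0 →
      e0 (some ⟨r - 1, by omega⟩) = 0 → ∀ N,
      ∑ x ∈ antidiagonal N, (-1 : ℚ) ^ x.1 * coeff (e0 + Finsupp.single none x.1 +
        Finsupp.single (some ⟨r - 1, by omega⟩) x.2) g = coeff (e0 + Finsupp.single none N) g := by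
  have hne : (none : Option (Fin r)) ≠ some ⟨r - 1, by omega⟩ := by simp
  unfold AlphaRel
  have H1 := coeff_merge (none : Option (Fin r)) (some ⟨r - 1, by omega⟩) hne (-1) 1
    (fun j : Option (Fin r) =>
      match j with
      | none => (-X none : PolyAT r)
      | some j => if (j : ℕ) = r - 1 then X none else X (some j)) (by simp) (by simp) (by
        rintro (_ | i) h1 h2
        · simp at h1
        · simp [Fin.ext_iff] at h1 h2
          simp [h2]) g
  have H2 := coeff_kill ({some ⟨r - 1, by omega⟩} : Set (Option (Fin r)))
    (fun j : Option (Fin r) =>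
      match j with
      | none => (X none : PolyAT r)
      | some j => if (j : ℕ) = r - 1 then 0 else X (some j)) (by rintro i rfl; simp) (by
        rintro (_ | i) h1
        · rfl
        · simp [Fin.ext_iff] at h1
          simp [h1]) g
  rw [MvPolynomial.ext_iff]
  constructor
  · intro H e0 h0 h0' N
    have := H (e0 + Finsupp.single none N + Finsupp.single (some ⟨r - 1, by omega⟩) 0)
    rw [H1 e0 h0 h0', H2, if_pos rfl, if_pos] at this
    · simpa using this
    · rintro i rfl; simp [h0']
  · intro H d
    obtain ⟨d0, hd, hd', hdd⟩ := exists_split _ _ hne d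
    generalize d none = N at hdd
    generalize d (some ⟨r - 1, by omega⟩) = M at hdd
    subst hdd
    rw [H1 d0 hd hd', H2]
    by_cases hM : M = 0
    · subst hM
      rw [if_pos rfl, if_pos]
      · simpa using H d0 hd hd' N
      · rintro i rfl; simp [hd']
    · rw [if_neg hM, if_neg]
      intro hh
      have := hh (some ⟨r - 1, by omega⟩) (by simp)
      simp [hd'] at this; omega

/-- positions of nonzero `t`-exponents -/
noncomputable def nzPos {r : ℕ} (e : Option (Fin r) →₀ ℕ) : List (Fin r) :=
  (List.finRange r).filter (fun i => decide (e (some i) ≠ 0))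

noncomputable def compT {r : ℕ} (e : Option (Fin r) →₀ ℕ) : List ℕ+ :=
  (nzPos e).map (fun i => (e (some i)).toPNat')

theorem exps_eq_iff {r : ℕ} (ω : List ℕ+) (l : Fin ω.length → Fin r) (hl : StrictMono l) (k : ℕ)
    (e : Option (Fin r) →₀ ℕ) :
    Finsupp.single none k + ∑ i, Finsupp.single (some (l i)) ((ω.get i : ℕ)) = e ↔
      k = e none ∧ List.ofFn l = nzPos e ∧ ∀ i, e (some (l i)) = ω.get i := by
  have hn : (Finsupp.single none k + ∑ i, Finsupp.single (some (l i)) ((ω.get i : ℕ)) :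
      Option (Fin r) →₀ ℕ) none = k := by
    simp [Finsupp.finsetSum_apply]
  have hs : ∀ j, (Finsupp.single none k + ∑ i, Finsupp.single (some (l i)) ((ω.get i : ℕ)) :
      Option (Fin r) →₀ ℕ) (some (l j)) = ω.get j := by
    intro j
    rw [Finsupp.add_apply, Finsupp.finsetSum_apply, Finset.sum_eq_single j]
    · simp
    · intro b _ hb
      rw [Finsupp.single_apply, if_neg]
      intro h; exact hb (hl.injective (Option.some_injective _ h))
    · simp
  have hz : ∀ x, (∀ j, l j ≠ x) →
      (Finsupp.single none k + ∑ i, Finsupp.single (some (l i)) ((ω.get i : ℕ)) :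
      Option (Fin r) →₀ ℕ) (some x) = 0 := by
    intro x hx
    rw [Finsupp.add_apply, Finsupp.finsetSum_apply, Finset.sum_eq_zero]
    · simp
    · intro b _
      rw [Finsupp.single_apply, if_neg]
      intro h; exact hx b (Option.some_injective _ h)
  constructor
  · intro h
    rw [h] at hn hs hz
    refine ⟨hn.symm, ?_, hs⟩
    apply List.Pairwise.eq_of_mem_iff (r := (· < ·))
    · rw [List.pairwise_ofFn]; intro i j hij; exact hl hij
    · exact (List.pairwise_lt_finRange r).filter _
    · intro x
      simp only [List.mem_ofFn, nzPos, List.mem_filter, List.mem_finRange, true_and,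
        decide_eq_true_eq]
      constructor
      · rintro ⟨j, rfl⟩; rw [hs j]; exact (ω.get j).ne_zero
      · intro hx
        by_contra hc
        exact hx (hz x (by simpa using hc))
  · rintro ⟨h1, h2, h3⟩
    ext x
    rcases x with _ | x
    · rw [hn, h1]
    · by_cases hx : ∃ j, l j = x
      · obtain ⟨j, rfl⟩ := hx
        rw [hs, h3]
      · rw [hz x (by simpa using hx)]
        have : x ∉ nzPos e := by rw [← h2, List.mem_ofFn]; exact hx
        symm
        simpa [nzPos] using this

theorem coeff_qsym {r : ℕ} (ω : List ℕ+) (k : ℕ) (e : Option (Fin r) →₀ ℕ) :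
    coeff e ((X none : PolyAT r) ^ k * qsymMonomial r ω) =
      if (e none, compT e) = (k, ω) then 1 else 0 := by
  have h1 : ∀ l : Fin ω.length → Fin r,
      (X none : PolyAT r) ^ k * ∏ i : Fin ω.length, X (some (l i)) ^ ((ω.get i : ℕ)) =
      monomial (Finsupp.single none k + ∑ i, Finsupp.single (some (l i)) ((ω.get i : ℕ))) 1 := by
    intro l
    simp only [X_pow_eq_monomial]
    rw [← monomial_sum_one, monomial_mul, one_mul]
  unfold qsymMonomial
  rw [Finset.mul_sum, coeff_sum]
  simp only [h1, coeff_monomial]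
  split_ifs with h
  · simp only [Prod.mk.injEq] at h
    obtain ⟨rfl, rfl⟩ := h
    have hlen : (compT e).length = (nzPos e).length := by simp [compT]
    let l : Fin (compT e).length → Fin r := fun i => (nzPos e).get (i.cast hlen)
    have hof : List.ofFn l = nzPos e := by
      apply List.ext_getElem
      · simp [hlen]
      · intro i h1 h2
        simp [l]
    have hl : StrictMono l := by
      have : (nzPos e).Pairwise (· < ·) := (List.pairwise_lt_finRange r).filter _
      rw [← hof, List.pairwise_ofFn] at this
      exact fun i j hij => this hij
    rw [Finset.sum_eq_single l]
    · rw [if_pos]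
      rw [exps_eq_iff _ l hl]
      refine ⟨rfl, hof, ?_⟩
      intro i
      have hmem : l i ∈ nzPos e := List.get_mem _ _
      have hne : e (some (l i)) ≠ 0 := by simpa [nzPos] using hmem
      have hget : (compT e).get i = (e (some (l i))).toPNat' :=
        List.getElem_map (fun i => (e (some i)).toPNat') (l := nzPos e) (i := i) (h := i.2)
      rw [hget, Nat.toPNat'_coe, if_pos (Nat.pos_of_ne_zero hne)]
    · intro l' hl' hne
      rw [if_neg]
      rw [exps_eq_iff _ l' (by simpa using hl')]
      rintro ⟨_, h2, _⟩
      exact hne (List.ofFn_injective (h2.trans hof.symm))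
    · intro hh; simp [hl] at hh
  · apply Finset.sum_eq_zero
    intro l hl
    rw [if_neg]
    rw [exps_eq_iff _ l (by simpa using hl)]
    rintro ⟨h1, h2, h3⟩
    apply h
    rw [Prod.mk.injEq]
    refine ⟨h1.symm, ?_⟩
    rw [compT, ← h2]
    apply List.ext_getElem
    · simp
    · intro i hi1 hi2
      simp only [List.getElem_map, List.getElem_ofFn, h3]
      simp

theorem coeff_eq_of_mem_span {r : ℕ} (g : PolyAT r) (hg : g ∈ Submodule.span ℚ
            (Set.range fun p : ℕ × List ℕ+ => (X none : PolyAT r) ^ p.1 * qsymMonomial r p.2))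
    (e e' : Option (Fin r) →₀ ℕ) (h : (e none, compT e) = (e' none, compT e')) :
    coeff e g = coeff e' g := by
  induction hg using Submodule.span_induction with
  | mem x hx =>
    obtain ⟨p, rfl⟩ := hx
    simp only [coeff_qsym, h]
  | zero => simp
  | add x y _ _ h1 h2 => simp [h1, h2]
  | smul a x _ h1 => simp [h1]

theorem mem_span_of_coeff_eq {r : ℕ} (g : PolyAT r)
    (h : ∀ e e' : Option (Fin r) →₀ ℕ, (e none, compT e) = (e' none, compT e') →
      coeff e g = coeff e' g) :
    g ∈ Submodule.span ℚ
      (Set.range fun p : ℕ × List ℕ+ => (X none : PolyAT r) ^ p.1 * qsymMonomial r p.2) := by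
  let H : ℕ × List ℕ+ → ℚ := fun p =>
    if hp : ∃ e : Option (Fin r) →₀ ℕ, (e none, compT e) = p then coeff hp.choose g else 0
  have hH : ∀ e : Option (Fin r) →₀ ℕ, H (e none, compT e) = coeff e g := by
    intro e
    have hp : ∃ e' : Option (Fin r) →₀ ℕ, (e' none, compT e') = (e none, compT e) := ⟨e, rfl⟩
    simp only [H]
    rw [dif_pos hp]
    exact h _ _ hp.choose_spec
  have : g = ∑ p ∈ g.support.image (fun e => (e none, compT e)),
      H p • ((X none : PolyAT r) ^ p.1 * qsymMonomial r p.2) := by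
    ext e
    rw [coeff_sum]
    simp only [coeff_smul, coeff_qsym, smul_eq_mul]
    simp only [Prod.mk.eta, mul_ite, mul_one, mul_zero, Finset.sum_ite_eq]
    split_ifs with hm
    · rw [hH]
    · by_contra hc
      apply hm
      rw [Finset.mem_image]
      exact ⟨e, by simpa using hc, rfl⟩
  rw [this]
  apply Submodule.sum_mem
  intro p _
  exact Submodule.smul_mem _ _ (Submodule.subset_span ⟨p, rfl⟩)

section phi
variable {A : Type*} [Ring A] [Algebra ℚ A]

/-- the word attached to an exponent vector -/
noncomputable def phi (z : ℕ → A) {r : ℕ} (e : Option (Fin r) →₀ ℕ) : A :=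
  ((List.finRange r).map fun i => z (e (some i))).prod * z (e none + 1)

theorem prod_filter_aux {M ι : Type*} [Monoid M] (z : ℕ → M) (h0 : z 0 = 1) (f : ι → ℕ)
    (L : List ι) :
    (L.map fun i => z (f i)).prod =
      (((L.filter (fun i => decide (f i ≠ 0))).map (fun i => (f i).toPNat')).map
        (fun a : ℕ+ => z (a : ℕ))).prod := by
  induction L with
  | nil => simp
  | cons a L ih =>
    by_cases h : f a = 0
    · simp only [List.map_cons, List.prod_cons, ih]
      rw [List.filter_cons_of_neg (by simp [h])]
      simp [h, h0]
    · simp only [List.map_cons, List.prod_cons, ih]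
      rw [List.filter_cons_of_pos (by simp [h])]
      simp only [List.map_cons, List.prod_cons]
      rw [Nat.toPNat'_coe, if_pos (Nat.pos_of_ne_zero h)]

theorem sum_filter_aux {ι : Type*} (f : ι → ℕ) (L : List ι) :
    (L.map f).sum =
      (((L.filter (fun i => decide (f i ≠ 0))).map (fun i => (f i).toPNat')).map
        (fun a : ℕ+ => (a : ℕ))).sum := by
  induction L with
  | nil => simp
  | cons a L ih =>
    by_cases h : f a = 0
    · simp only [List.map_cons, List.sum_cons, ih]
      rw [List.filter_cons_of_neg (by simp [h])]
      simp [h]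
    · simp only [List.map_cons, List.sum_cons, ih]
      rw [List.filter_cons_of_pos (by simp [h])]
      simp only [List.map_cons, List.sum_cons]
      rw [Nat.toPNat'_coe, if_pos (Nat.pos_of_ne_zero h)]

theorem phi_congr (z : ℕ → A) (h0 : z 0 = 1) {r : ℕ} (e e' : Option (Fin r) →₀ ℕ)
    (h : (e none, compT e) = (e' none, compT e')) : phi z e = phi z e' := by
  rw [Prod.mk.injEq] at h
  unfold phi
  rw [prod_filter_aux z h0 (fun i => e (some i)), prod_filter_aux z h0 (fun i => e' (some i)), h.1]
  congr 3
  exact h.2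

theorem sum_eq {r : ℕ} (e : Option (Fin r) →₀ ℕ) :
    Finset.univ.sum e = e none + ((compT e).map (fun a : ℕ+ => (a : ℕ))).sum := by
  rw [Fintype.sum_option, compT, nzPos, ← sum_filter_aux (fun i => e (some i)),
    ← List.ofFn_eq_map, List.sum_ofFn]

theorem sum_congr' {r : ℕ} (e e' : Option (Fin r) →₀ ℕ)
    (h : (e none, compT e) = (e' none, compT e')) : Finset.univ.sum e = Finset.univ.sum e' := by
  rw [Prod.mk.injEq] at h
  rw [sum_eq, sum_eq, h.1, h.2]

noncomputable def polyOf (z : ℕ → A) (r n : ℕ) (π : A →ₗ[ℚ] ℚ) : PolyAT r :=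
  ∑ e ∈ (Finset.univ : Finset (Option (Fin r))).finsuppAntidiag n, monomial e (π (phi z e))

theorem coeff_polyOf (z : ℕ → A) (r n : ℕ) (π : A →ₗ[ℚ] ℚ) (e : Option (Fin r) →₀ ℕ) :
    coeff e (polyOf z r n π) = if Finset.univ.sum e = n then π (phi z e) else 0 := by
  unfold polyOf
  rw [coeff_sum]
  simp only [coeff_monomial, Finset.sum_ite_eq', Finset.mem_finsuppAntidiag, Finset.subset_univ,
    and_true]

theorem polyOf_homog (z : ℕ → A) (r n : ℕ) (π : A →ₗ[ℚ] ℚ) :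
    (polyOf z r n π).IsHomogeneous n := by
  unfold polyOf
  apply IsHomogeneous.sum
  intro e he
  apply isHomogeneous_monomial
  rw [Finset.mem_finsuppAntidiag] at he
  rw [Finsupp.degree_eq_sum]
  exact he.1

theorem polyOf_span (z : ℕ → A) (h0 : z 0 = 1) (r n : ℕ) (π : A →ₗ[ℚ] ℚ) :
    polyOf z r n π ∈ Submodule.span ℚ
      (Set.range fun p : ℕ × List ℕ+ => (X none : PolyAT r) ^ p.1 * qsymMonomial r p.2) := by
  apply mem_span_of_coeff_eq
  intro e e' h
  rw [coeff_polyOf, coeff_polyOf, phi_congr z h0 e e' h, sum_congr' e e' h]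

theorem phi_split (z : ℕ → A) {r : ℕ} (q : ℕ) (hq : q + 1 < r) (e0 : Option (Fin r) →₀ ℕ)
    (h : e0 (some ⟨q, by omega⟩) = 0) (h' : e0 (some ⟨q + 1, hq⟩) = 0) :
    ∃ P Q : A, ∀ i j, phi z (e0 + Finsupp.single (some ⟨q, by omega⟩) i +
        Finsupp.single (some ⟨q + 1, hq⟩) j) = P * (z i * z j) * Q := by
  obtain ⟨l1, l2, hl⟩ : ∃ l1 l2 : List (Fin r),
      List.finRange r = l1 ++ ⟨q, by omega⟩ :: ⟨q + 1, hq⟩ :: l2 := by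
    refine ⟨(List.finRange r).take q, (List.finRange r).drop (q + 2), ?_⟩
    conv_lhs => rw [← List.take_append_drop q (List.finRange r)]
    rw [List.drop_eq_getElem_cons (by simp; omega), List.drop_eq_getElem_cons (by simp; omega)]
    simp
  have hnd := List.nodup_finRange r
  rw [hl, List.nodup_append] at hnd
  obtain ⟨_, h2, h3⟩ := hnd
  simp only [List.nodup_cons, List.mem_cons, not_or] at h2
  refine ⟨(l1.map fun i => z (e0 (some i))).prod,
    (l2.map fun i => z (e0 (some i))).prod * z (e0 none + 1), ?_⟩
  intro i j
  unfold phi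
  rw [hl, List.map_append, List.prod_append, List.map_cons, List.map_cons, List.prod_cons,
    List.prod_cons]
  have e1 : l1.map (fun x => z ((e0 + Finsupp.single (some ⟨q, by omega⟩) i +
        Finsupp.single (some ⟨q + 1, hq⟩) j : Option (Fin r) →₀ ℕ) (some x))) =
      l1.map fun i => z (e0 (some i)) := by
    apply List.map_congr_left
    intro x hx
    have a1 := h3 x hx _ (List.mem_cons_self)
    have a2 := h3 x hx ⟨q + 1, hq⟩ (by simp)
    simp [Finsupp.single_apply, Ne.symm a1, Ne.symm a2]
  have e2 : l2.map (fun x => z ((e0 + Finsupp.single (some ⟨q, by omega⟩) i +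
        Finsupp.single (some ⟨q + 1, hq⟩) j : Option (Fin r) →₀ ℕ) (some x))) =
      l2.map fun i => z (e0 (some i)) := by
    apply List.map_congr_left
    intro x hx
    have a1 : (⟨q, by omega⟩ : Fin r) ≠ x := by rintro rfl; exact h2.1.2 hx
    have a2 : (⟨q + 1, hq⟩ : Fin r) ≠ x := by rintro rfl; exact h2.2.1 hx
    simp [Finsupp.single_apply, a1, a2]
  rw [e1, e2]
  simp [h, h', mul_assoc]

theorem phi_split' (z : ℕ → A) {r : ℕ} (hr : 0 < r) (e0 : Option (Fin r) →₀ ℕ)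
    (h : e0 none = 0) (h' : e0 (some ⟨r - 1, by omega⟩) = 0) :
    ∃ P : A, ∀ i j, phi z (e0 + Finsupp.single none i +
        Finsupp.single (some ⟨r - 1, by omega⟩) j) = P * (z j * z (i + 1)) := by
  obtain ⟨l1, hl⟩ : ∃ l1 : List (Fin r),
      List.finRange r = l1 ++ [(⟨r - 1, by omega⟩ : Fin r)] := by
    refine ⟨(List.finRange r).take (r - 1), ?_⟩
    conv_lhs => rw [← List.take_append_drop (r - 1) (List.finRange r)]
    rw [List.drop_eq_getElem_cons (by simp; omega)]
    simp
    omega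
  have hnd := List.nodup_finRange r
  rw [hl, List.nodup_append] at hnd
  obtain ⟨_, h2, h3⟩ := hnd
  refine ⟨(l1.map fun i => z (e0 (some i))).prod, ?_⟩
  intro i j
  unfold phi
  rw [hl, List.map_append, List.prod_append]
  have e1 : l1.map (fun x => z ((e0 + Finsupp.single none i +
        Finsupp.single (some ⟨r - 1, by omega⟩) j : Option (Fin r) →₀ ℕ) (some x))) =
      l1.map fun i => z (e0 (some i)) := by
    apply List.map_congr_left
    intro x hx
    have a1 := h3 x hx _ (List.mem_cons_self)
    simp [Finsupp.single_apply, Ne.symm a1]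
  rw [e1]
  simp [h, h', mul_assoc]

theorem univ_sum_add3 {r : ℕ} (e0 : Option (Fin r) →₀ ℕ) (p p' : Option (Fin r)) (i j : ℕ) :
    Finset.univ.sum (e0 + Finsupp.single p i + Finsupp.single p' j) =
      Finset.univ.sum e0 + (i + j) := by
  simp [Finset.sum_add_distrib, Finsupp.single_apply, add_assoc]

theorem polyOf_cancel (z : ℕ → A)
    (hz : ∀ N, 1 ≤ N → ∑ p ∈ antidiagonal N, (-1 : ℚ) ^ p.2 • (z p.1 * z p.2) = 0)
    (r n : ℕ) (π : A →ₗ[ℚ] ℚ) (q : ℕ) (hq : q + 1 < r) :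
    CancelRel (polyOf z r n π) q hq := by
  rw [cancel_iff]
  intro e0 h h' N hN
  obtain ⟨P, Q, hPQ⟩ := phi_split z q hq e0 h h'
  have : ∀ x ∈ antidiagonal N, (-1 : ℚ) ^ x.2 * coeff (e0 +
      Finsupp.single (some ⟨q, by omega⟩) x.1 +
        Finsupp.single (some ⟨q + 1, hq⟩) x.2) (polyOf z r n π) =
      if Finset.univ.sum e0 + N = n then π (P * ((-1 : ℚ) ^ x.2 • (z x.1 * z x.2)) * Q) else 0 := by
    rintro ⟨i, j⟩ hx
    rw [mem_antidiagonal] at hx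
    rw [coeff_polyOf, univ_sum_add3, hPQ, hx]
    split_ifs
    · simp
    · simp
  rw [Finset.sum_congr rfl this]
  split_ifs
  · rw [← map_sum, ← Finset.sum_mul, ← Finset.mul_sum, hz N hN]; simp
  · simp

theorem polyOf_alpha (z : ℕ → A) (h0 : z 0 = 1)
    (hz : ∀ N, 1 ≤ N → ∑ p ∈ antidiagonal N, (-1 : ℚ) ^ p.2 • (z p.1 * z p.2) = 0)
    (r n : ℕ) (hr : 0 < r) (π : A →ₗ[ℚ] ℚ) :
    AlphaRel r (polyOf z r n π) := by
  rw [alpha_iff hr]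
  intro e0 h h' N
  obtain ⟨P, hP⟩ := phi_split' z hr e0 h h'
  have : ∀ x ∈ antidiagonal N, (-1 : ℚ) ^ x.1 * coeff (e0 +
      Finsupp.single none x.1 +
        Finsupp.single (some ⟨r - 1, by omega⟩) x.2) (polyOf z r n π) =
      if Finset.univ.sum e0 + N = n then
        π (P * ((-1 : ℚ) ^ x.1 • (z x.2 * z (x.1 + 1)))) else 0 := by
    rintro ⟨i, j⟩ hx
    rw [mem_antidiagonal] at hx
    rw [coeff_polyOf, univ_sum_add3, hP, hx]
    split_ifs
    · simp
    · simp
  rw [Finset.sum_congr rfl this]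
  have e : e0 + Finsupp.single none N = e0 + Finsupp.single none N +
      Finsupp.single (some ⟨r - 1, by omega⟩) 0 := by simp
  rw [e, coeff_polyOf, univ_sum_add3, hP, add_zero]
  split_ifs
  · rw [← map_sum, ← Finset.mul_sum]
    congr 2
    have := hz (N + 1) (by omega)
    rw [Finset.Nat.sum_antidiagonal_succ'] at this
    rw [← Finset.Nat.sum_antidiagonal_swap]
    simp only [h0, pow_zero, one_smul, mul_one, one_mul, Prod.fst_swap, Prod.snd_swap] at this ⊢
    rw [eq_comm, ← sub_eq_zero, ← this, sub_eq_add_neg, ← Finset.sum_neg_distrib]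
    congr 1
    apply Finset.sum_congr rfl
    intro x _
    rw [pow_succ]; simp
  · simp
end phi

/-- exponent vector with prescribed `t`-exponents (padded by zeros) and `α`-exponent -/
noncomputable def mkE (r : ℕ) (w : List ℕ) (k : ℕ) : Option (Fin r) →₀ ℕ :=
  Finsupp.equivFunOnFinite.symm (fun o => match o with
    | none => k
    | some i => w.getD i 0)

@[simp] theorem mkE_none (r : ℕ) (w : List ℕ) (k : ℕ) : mkE r w k none = k := rfl

@[simp] theorem mkE_some (r : ℕ) (w : List ℕ) (k : ℕ) (i : Fin r) :
    mkE r w k (some i) = w.getD i 0 := rfl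

theorem map_mkE (r : ℕ) (w : List ℕ) (k : ℕ) (h : w.length ≤ r) :
    (List.finRange r).map (fun i => mkE r w k (some i)) =
      w ++ List.replicate (r - w.length) 0 := by
  apply List.ext_getElem
  · simp; omega
  · intro i h1 h2
    simp only [List.getElem_map, List.getElem_finRange, mkE_some, List.getElem_append,
      List.getElem_replicate]
    split_ifs with hi
    · simp [hi]
    · simp only [List.getD_eq_getElem?_getD]
      rw [List.getElem?_eq_none (by simpa using hi)]; rfl

theorem compT_mkE (r : ℕ) (w : List ℕ) (k : ℕ) (h : w.length ≤ r) :
    compT (mkE r w k) = (w.filter (fun x => decide (x ≠ 0))).map Nat.toPNat' := by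
  have : compT (mkE r w k) = (((List.finRange r).map (fun i => mkE r w k (some i))).filter
      (fun x => decide (x ≠ 0))).map Nat.toPNat' := by
    rw [List.filter_map, List.map_map]; rfl
  rw [this, map_mkE r w k h, List.filter_append]
  simp

theorem sum_mkE (r : ℕ) (w : List ℕ) (k : ℕ) (h : w.length ≤ r) :
    Finset.univ.sum (mkE r w k) = w.sum + k := by
  rw [Fintype.sum_option, mkE_none, ← List.sum_ofFn, List.ofFn_eq_map, map_mkE r w k h]
  simp [add_comm]

theorem phi_mkE {A : Type*} [Ring A] (z : ℕ → A) (h0 : z 0 = 1) (r : ℕ) (w : List ℕ) (k : ℕ)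
    (h : w.length ≤ r) :
    phi z (mkE r w k) = ((w ++ [k + 1]).map z).prod := by
  have : (List.finRange r).map (fun i => z (mkE r w k (some i))) =
      ((List.finRange r).map (fun i => mkE r w k (some i))).map z := by
    rw [List.map_map]; rfl
  rw [phi, this, map_mkE r w k h]
  simp [h0]

theorem mkE_split (r q : ℕ) (hq : q + 1 < r) (s t : List ℕ) (hs : s.length = q) (i j k : ℕ) :
    mkE r (s ++ i :: j :: t) k = mkE r (s ++ 0 :: 0 :: t) k +
      Finsupp.single (some ⟨q, by omega⟩) i + Finsupp.single (some ⟨q + 1, hq⟩) j := by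
  subst hs
  ext x
  rcases x with _ | ⟨x, hx⟩
  · simp
  · simp only [Finsupp.add_apply, mkE_some, List.getD_eq_getElem?_getD, Finsupp.single_apply,
      Option.some.injEq, Fin.mk.injEq]
    rcases lt_trichotomy x s.length with h | h | h
    · rw [List.getElem?_append_left h, List.getElem?_append_left h, if_neg (by omega),
        if_neg (by omega)]; simp
    · subst h; simp
    · rw [List.getElem?_append_right h.le, List.getElem?_append_right h.le, if_neg (by omega)]
      obtain ⟨y, rfl⟩ : ∃ y, x = s.length + 1 + y := ⟨x - s.length - 1, by omega⟩
      rw [show s.length + 1 + y - s.length = y + 1 by omega]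
      rcases y with _ | y
      · simp
      · simp

theorem mkE_split' (r : ℕ) (hr : 0 < r) (w : List ℕ) (hw : w.length ≤ r - 1) (i j : ℕ) :
    mkE r (w ++ List.replicate (r - 1 - w.length) 0 ++ [j]) i = mkE r w 0 +
      Finsupp.single none i + Finsupp.single (some ⟨r - 1, by omega⟩) j := by
  ext x
  rcases x with _ | ⟨x, hx⟩
  · simp
  · simp only [Finsupp.add_apply, mkE_some, List.getD_eq_getElem?_getD, Finsupp.single_apply,
      Option.some.injEq, Fin.mk.injEq]
    have hlen : (w ++ List.replicate (r - 1 - w.length) 0).length = r - 1 := by simp; omega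
    by_cases h : x = r - 1
    · subst h
      rw [List.getElem?_append_right hlen.le, hlen, List.getElem?_eq_none hw]; simp
    · rw [List.getElem?_append_left (by omega), if_neg (by simp), if_neg (by omega)]
      by_cases h2 : x < w.length
      · rw [List.getElem?_append_left h2]; simp
      · rw [List.getElem?_append_right (by omega), List.getElem?_eq_none (l := w) (by omega)]
        rw [List.getElem?_replicate]
        split_ifs <;> simp

theorem vanish (n r : ℕ) (hn : 1 ≤ n) (hr : n ≤ r) (g : PolyAT r) (hhom : g.IsHomogeneous n)
    (hspan : g ∈ Submodule.span ℚ
      (Set.range fun p : ℕ × List ℕ+ => (X none : PolyAT r) ^ p.1 * qsymMonomial r p.2))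
    (hc : ∀ (q : ℕ) (hq : q + 1 < r), CancelRel g q hq) (ha : AlphaRel r g)
    (hodd : ∀ w k, (∀ x ∈ w ++ [k + 1], Odd x) → w.sum + k = n → coeff (mkE r w k) g = 0) :
    g = 0 := by
  have hcomp := coeff_eq_of_mem_span g hspan
  have hcg : ∀ (w w' : List ℕ) k, w.length ≤ r → w'.length ≤ r →
      w.filter (fun x => decide (x ≠ 0)) = w'.filter (fun x => decide (x ≠ 0)) →
      coeff (mkE r w k) g = coeff (mkE r w' k) g := by
    intro w w' k h h' hf
    apply hcomp
    rw [compT_mkE r w k h, compT_mkE r w' k h', hf]; rfl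
  have step : ∀ d (w : List ℕ) k, (∀ x ∈ w, 1 ≤ x) → w.sum + k = n → n < w.length + d →
      coeff (mkE r w k) g = 0 := by
    intro d
    induction d with
    | zero =>
      intro w k hw hs hd
      have := List.length_le_sum_of_one_le w hw
      omega
    | succ d ih =>
      intro w k hw hs hd
      by_cases h1 : ∃ x ∈ w, ¬ Odd x
      · obtain ⟨x, hx, hox⟩ := h1
        obtain ⟨s, t, rfl⟩ := List.append_of_mem hx
        have hx1 : 1 ≤ x := hw x (by simp)
        have hxe : Even x := by simpa using hox
        have hx2 : 2 ≤ x := by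
          obtain ⟨m, hm⟩ := hxe; omega
        have hls := List.length_le_sum_of_one_le s (fun y hy => hw y (by simp [hy]))
        have hlt := List.length_le_sum_of_one_le t (fun y hy => hw y (by simp [hy]))
        simp only [List.sum_append, List.sum_cons, List.length_append, List.length_cons] at hs hd
        have hq : s.length + 1 < r := by omega
        have rel := (cancel_iff g s.length hq).1 (hc _ hq) (mkE r (s ++ 0 :: 0 :: t) k)
          (by simp) (by
            rw [mkE_some, List.getD_eq_getElem?_getD, List.getElem?_append_right (by simp)]
            simp) x hx1
        simp only [← mkE_split r s.length hq s t rfl] at rel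
        rw [Finset.sum_eq_add (x, 0) (0, x)] at rel
        · simp only [hxe.neg_one_pow, pow_zero, one_mul] at rel
          rw [hcg (s ++ x :: 0 :: t) (s ++ x :: t) k (by simp; omega) (by simp; omega)
            (by simp [List.filter_cons]), hcg (s ++ 0 :: x :: t) (s ++ x :: t) k (by simp; omega) (by simp; omega)
            (by simp [List.filter_cons])] at rel
          linarith
        · simp; omega
        · rintro ⟨i, j⟩ hij ⟨h1, h2⟩
          rw [mem_antidiagonal] at hij
          simp only at hij
          have hi : i ≠ 0 := by rintro rfl; apply h2; simp at hij; rw [hij]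
          have hj : j ≠ 0 := by rintro rfl; apply h1; simp at hij; rw [hij]
          simp only
          rw [ih (s ++ i :: j :: t) k, mul_zero]
          · intro y hy
            simp only [List.mem_append, List.mem_cons] at hy
            rcases hy with hy | rfl | rfl | hy
            · exact hw y (by simp [hy])
            · omega
            · omega
            · exact hw y (by simp [hy])
          · simp; omega
          · simp; omega
        · simp
        · simp
      · push Not at h1
        by_cases h2 : Odd (k + 1)
        · apply hodd w k _ hs
          intro x hx
          simp only [List.mem_append, List.mem_singleton] at hx
          rcases hx with hx | rfl
          · exact h1 x hx
          · exact h2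
        · have hk : Odd k := by
            rw [Nat.odd_add_one] at h2; simpa using h2
          have hk1 : 1 ≤ k := hk.pos
          have hlw := List.length_le_sum_of_one_le w hw
          have hr0 : 0 < r := by omega
          have rel := (alpha_iff hr0 g).1 ha (mkE r w 0) (by simp)
            (by simp [List.getElem?_eq_none (l := w) (i := r - 1) (by omega)]) k
          have e1 : mkE r w 0 + Finsupp.single none k = mkE r w k := by
            ext x; rcases x with _ | x <;> simp
          simp only [← mkE_split' r hr0 w (by omega), e1] at rel
          rw [Finset.sum_eq_single (k, 0)] at rel
          · simp only [hk.neg_one_pow] at rel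
            rw [hcg _ w k (by simp; omega) (by omega) (by simp)] at rel
            linarith
          · rintro ⟨i, j⟩ hij hne
            rw [mem_antidiagonal] at hij
            simp only at hij
            have hj : j ≠ 0 := by rintro rfl; apply hne; simp at hij; rw [hij]
            simp only
            rw [hcg _ (w ++ [j]) i (by simp; omega) (by simp; omega) (by simp),
              ih (w ++ [j]) i, mul_zero]
            · intro y hy
              simp only [List.mem_append, List.mem_singleton] at hy
              rcases hy with hy | rfl
              · exact hw y hy
              · omega
            · simp; omega
            · simp; omega
          · simp
  ext e
  rw [coeff_zero]
  by_cases he : Finset.univ.sum e = n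
  · have hs := sum_eq e
    set w := (compT e).map (fun a : ℕ+ => (a : ℕ)) with hw
    have hpos : ∀ x ∈ w, 1 ≤ x := by
      intro x hx
      rw [hw, List.mem_map] at hx
      obtain ⟨a, _, rfl⟩ := hx
      exact a.2
    have hlw := List.length_le_sum_of_one_le w hpos
    rw [hcomp e (mkE r w (e none))]
    · exact step (n + 1) w _ hpos (by omega) (by omega)
    · rw [compT_mkE _ _ _ (by omega), mkE_none, List.filter_eq_self.2, hw, List.map_map]
      · congr 1
        symm
        convert List.map_id _
        ext a
        simp
      · intro a ha
        have := hpos a ha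
        simp; omega
  · apply hhom.coeff_eq_zero
    rw [Finsupp.degree_eq_sum]
    exact he

theorem oddComp_split (n : ℕ) (c : oddComp n) :
    ∃ w : List ℕ, ∃ k, (c : List ℕ) = w ++ [k + 1] ∧ w.sum + k = n ∧ w.length ≤ n := by
  obtain ⟨c, hc⟩ := c
  rw [mem_oddComp] at hc
  rcases List.eq_nil_or_concat' c with rfl | ⟨w, m, rfl⟩
  · simp at hc
  · obtain ⟨h1, h2⟩ := hc
    have hm : Odd m := h1 m (by simp)
    obtain ⟨k, rfl⟩ : ∃ k, m = k + 1 := ⟨m - 1, by have := hm.pos; omega⟩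
    have hlw := List.length_le_sum_of_one_le w (fun y hy => (h1 y (by simp [hy])).pos)
    simp at h2
    exact ⟨w, k, rfl, by omega, by omega⟩

/-- the space of the theorem -/
noncomputable def theSpace (n r : ℕ) : Submodule ℚ (PolyAT r) where
  carrier := {g | g.IsHomogeneous n ∧
          g ∈ Submodule.span ℚ
            (Set.range fun p : ℕ × List ℕ+ => (X none : PolyAT r) ^ p.1 * qsymMonomial r p.2) ∧
          (∀ (q : ℕ) (hq : q + 1 < r), CancelRel g q hq) ∧
          AlphaRel r g}
  zero_mem' := ⟨isHomogeneous_zero _ _ _, Submodule.zero_mem _,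
    by intro q hq; simp [CancelRel], by simp [AlphaRel]⟩
  add_mem' := by
    rintro a b ⟨a1, a2, a3, a4⟩ ⟨b1, b2, b3, b4⟩
    refine ⟨a1.add b1, Submodule.add_mem _ a2 b2, ?_, ?_⟩
    · intro q hq
      have := a3 q hq
      have := b3 q hq
      unfold CancelRel at *
      rw [map_add, map_add]; congr 1
    · unfold AlphaRel at *
      rw [map_add, map_add, a4, b4]
  smul_mem' := by
    rintro c b ⟨b1, b2, b3, b4⟩
    refine ⟨?_, Submodule.smul_mem _ _ b2, ?_, ?_⟩
    · exact (homogeneousSubmodule (Option (Fin r)) ℚ n).smul_mem c b1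
    · intro q hq
      have := b3 q hq
      unfold CancelRel at *
      rw [map_smul, map_smul]; congr 1
    · unfold AlphaRel at *
      rw [map_smul, map_smul, b4]

theorem finrank_theSpace (n r : ℕ) (hn : 1 ≤ n) (hr : n ≤ r) :
    Module.finrank ℚ (theSpace n r) = Nat.fib (n + 1) := by
  obtain ⟨z, h0, hzo, hz⟩ := exists_z (A := MonoidAlgebra ℚ (FreeMonoid ℕ))
    (fun i => MonoidAlgebra.single (FreeMonoid.of i) 1)
  let π : List ℕ → MonoidAlgebra ℚ (FreeMonoid ℕ) →ₗ[ℚ] ℚ := fun c =>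
    { toFun := fun a => a.coeff (FreeMonoid.ofList c)
      map_add' := by intro a b; simp
      map_smul' := by intro a b; simp }
  have hprod : ∀ c : List ℕ, (∀ x ∈ c, Odd x) →
      (c.map z).prod = MonoidAlgebra.single (FreeMonoid.ofList c) 1 := by
    intro c
    induction c with
    | nil => intro _; rfl
    | cons a c ih =>
      intro h
      rw [List.map_cons, List.prod_cons, ih (fun x hx => h x (by simp [hx])), hzo a (h a (by simp)),
        MonoidAlgebra.single_mul_single, one_mul]
      rfl
  let b : oddComp n → PolyAT r := fun c => polyOf z r n (π c)
  choose w k hw hwk hwl using oddComp_split n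
  have hco : ∀ c c' : oddComp n, coeff (mkE r (w c') (k c')) (b c) = if c' = c then 1 else 0 := by
    intro c c'
    simp only [b]
    have hl : (w c').length ≤ r := (hwl c').trans hr
    rw [coeff_polyOf, sum_mkE _ _ _ hl, if_pos (hwk c'), phi_mkE z h0 r _ _ hl, ← hw,
      hprod _ ((mem_oddComp n _).1 c'.2).1]
    change (MonoidAlgebra.single (FreeMonoid.ofList (c' : List ℕ)) (1 : ℚ)).coeff
      (FreeMonoid.ofList (c : List ℕ)) = _
    rw [MonoidAlgebra.coeff_single, Finsupp.single_apply]
    congr 1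
    rw [eq_iff_iff, FreeMonoid.ofList.injective.eq_iff, Subtype.ext_iff]
  have hbm : ∀ c, b c ∈ theSpace n r := fun c =>
    ⟨polyOf_homog z r n _, polyOf_span z h0 r n _, polyOf_cancel z hz r n _,
      polyOf_alpha z h0 hz r n (by omega) _⟩
  have hcs : ∀ (f : oddComp n → ℚ) c',
      coeff (mkE r (w c') (k c')) (∑ c, f c • b c) = f c' := by
    intro f c'
    rw [coeff_sum]
    simp [coeff_smul, hco]
  have hli : LinearIndependent ℚ b := by
    rw [Fintype.linearIndependent_iff]
    intro f hf c'
    rw [← hcs f c', hf, coeff_zero]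
  have hsp : theSpace n r = Submodule.span ℚ (Set.range b) := by
    apply le_antisymm
    · intro g hg
      let f : oddComp n → ℚ := fun c => coeff (mkE r (w c) (k c)) g
      have hmem : ∑ c, f c • b c ∈ Submodule.span ℚ (Set.range b) :=
        Submodule.sum_mem _ fun c _ => Submodule.smul_mem _ _ (Submodule.subset_span ⟨c, rfl⟩)
      have hd : g - ∑ c, f c • b c ∈ theSpace n r :=
        Submodule.sub_mem _ hg (Submodule.sum_mem _ fun c _ => Submodule.smul_mem _ _ (hbm c))
      obtain ⟨d1, d2, d3, d4⟩ := hd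
      have := vanish n r hn hr _ d1 d2 d3 d4 (by
        intro w' k' ho hs
        have hmem : w' ++ [k' + 1] ∈ oddComp n := by
          rw [mem_oddComp]; exact ⟨ho, by simp; omega⟩
        have hh := hw ⟨_, hmem⟩
        simp only at hh
        obtain ⟨h1, h2⟩ := List.append_inj' hh rfl
        simp only [List.cons.injEq, Nat.add_right_cancel_iff, and_true] at h2
        have key : mkE r w' k' = mkE r (w ⟨_, hmem⟩) (k ⟨_, hmem⟩) := congrArg₂ (mkE r) h1 h2
        rw [key, coeff_sub, hcs, sub_self])
      rw [sub_eq_zero.1 this]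
      exact hmem
    · rw [Submodule.span_le]
      rintro _ ⟨c, rfl⟩
      exact hbm c
  rw [hsp, finrank_span_eq_card hli, Fintype.card_coe, card_oddComp]

/-- For `n ≥ 1` and `r ≥ n`, the polynomials `g ∈ ℚ[α, t_1,…,t_r]` that are homogeneous of
total degree `n`, are `ℚ[α]`-linear combinations of quasi-symmetric monomials in the
`t`-variables, satisfy all cancellation relations in the `t`-variables, and satisfy
`g(−α, t_1,…,t_{r−1}, α) = g(α, t_1,…,t_{r−1}, 0)`, form a `ℚ`-subspace of dimension
`c_n = Nat.fib (n+1)`, the `n`-th Fibonacci number. -/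
theorem statement2 (n r : ℕ) (hn : 1 ≤ n) (hr : n ≤ r) :
    ∃ V : Submodule ℚ (PolyAT r),
      (V : Set (PolyAT r)) =
        {g | g.IsHomogeneous n ∧
          g ∈ Submodule.span ℚ
            (Set.range fun p : ℕ × List ℕ+ => (X none : PolyAT r) ^ p.1 * qsymMonomial r p.2) ∧
          (∀ (q : ℕ) (hq : q + 1 < r), CancelRel g q hq) ∧
          AlphaRel r g} ∧
      Module.finrank ℚ ↥V = Nat.fib (n + 1) := by
  exact ⟨theSpace n r, rfl, finrank_theSpace n r hn hr⟩
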